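/- arXiv:1004.5462 — 6 statements merged into one kernel-verified Lean document; each statement's English description precedes it below -/
import Mathlib

section
/- Let p be a prime number and let A be an element of SL₂(ℤ_p), the group of 2×2 matrices over the p-adic integers with determinant 1. Then there exists a matrix ε in GL₂(ℤ_p) (an invertible 2×2 matrix over ℤ_p) with det(ε) = −1 such that A = ε A⁻¹ ε⁻¹. -/
open Matrix

/-- Over a valuation ring, every plane `m x + b z + c y = 0` meets the quadric
`x ^ 2 + y z = 1`. -/
theorem ValuationRing.exists_sq_add_mul_eq_one {R : Type*} [CommRing R] [IsDomain R]
    [ValuationRing R] (m b c : R) :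
    ∃ x y z : R, x ^ 2 + y * z = 1 ∧ m * x + b * z + c * y = 0 := by
  by_cases hb : b ∣ m
  · obtain ⟨k, rfl⟩ := hb
    exact ⟨1, 0, -k, by ring, by ring⟩
  by_cases hc : c ∣ m
  · obtain ⟨k, rfl⟩ := hc
    exact ⟨1, -k, 0, by ring, by ring⟩
  obtain ⟨k, rfl⟩ := (ValuationRing.dvd_total b m).resolve_left hb
  obtain ⟨l, rfl⟩ := (ValuationRing.dvd_total c m).resolve_left hc
  have hk : k ∈ nonunits R := fun h ↦ hb (h.mul_right_dvd.2 dvd_rfl)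
  have hl : l ∈ nonunits R := fun h ↦ hc (h.mul_right_dvd.2 dvd_rfl)
  have hlk : l - k ∈ IsLocalRing.maximalIdeal R := sub_mem hl hk
  obtain ⟨u, hu⟩ := (IsLocalRing.isUnit_one_sub_self_of_mem_nonunits _ hlk).exists_right_inv
  refine ⟨1 + (2 * l - 1) * u, -2 - (2 * l - 1) * u, (2 * l - 1) * u, by ring, ?_⟩
  linear_combination m * (2 * l - 1) * hu

/-- Over a valuation ring, every element of `SL₂` is conjugate to its inverse by a matrix of
determinant `-1`. -/
theorem Matrix.SpecialLinearGroup.exists_det_eq_neg_one_conj_inv {R : Type*} [CommRing R]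
    [IsDomain R] [ValuationRing R] (A : SpecialLinearGroup (Fin 2) R) :
    ∃ ε : GeneralLinearGroup (Fin 2) R, (ε : Matrix (Fin 2) (Fin 2) R).det = -1 ∧
      (A : GeneralLinearGroup (Fin 2) R) =
        ε * (A : GeneralLinearGroup (Fin 2) R)⁻¹ * ε⁻¹ := by
  obtain ⟨x, y, z, hdet, htr⟩ :=
    ValuationRing.exists_sq_add_mul_eq_one (A 0 0 - A 1 1) (A 0 1) (A 1 0)
  have hsq : !![x, y; z, -x] * !![x, y; z, -x] = 1 := by
    ext i j
    fin_cases i <;> fin_cases j <;> simp <;> first | ring1 | linear_combination hdet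
  refine ⟨⟨!![x, y; z, -x], !![x, y; z, -x], hsq, hsq⟩, ?_, ?_⟩
  · simp only [det_fin_two_of]
    linear_combination -hdet
  · rw [eq_mul_inv_iff_mul_eq]
    ext i j
    fin_cases i <;> fin_cases j <;>
      simp [mul_apply, Fin.sum_univ_two, inv_def, adjugate_fin_two]
    all_goals first | ring1 | linear_combination htr

/-- For any prime `p` and any `A ∈ SL₂(ℤ_p)`, there is `ε ∈ GL₂(ℤ_p)` with `det ε = -1`
such that `A = ε A⁻¹ ε⁻¹`. -/
theorem sl2_padic_conjugate_to_inverse (p : ℕ) [Fact p.Prime]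
    (A : Matrix.SpecialLinearGroup (Fin 2) ℤ_[p]) :
    ∃ ε : Matrix.GeneralLinearGroup (Fin 2) ℤ_[p],
      ((ε : Matrix (Fin 2) (Fin 2) ℤ_[p])).det = -1 ∧
      (A : Matrix.GeneralLinearGroup (Fin 2) ℤ_[p]) =
        ε * (A : Matrix.GeneralLinearGroup (Fin 2) ℤ_[p])⁻¹ * ε⁻¹ := by
  exact A.exists_det_eq_neg_one_conj_inv
end

section
/- Let p be a prime number, let t be an element of ℤ_p, and let b, c be elements of ℤ_p that are both divisible by p. Then there exist y, z in ℤ_p satisfying t²·(b·z − c·y)² + y·z = 1. -/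
/-- Let `p` be a prime, `t ∈ ℤ_p`, and `b, c ∈ ℤ_p` both divisible by `p`. Then there exist
`y, z ∈ ℤ_p` with `t² (bz - cy)² + yz = 1`. -/
theorem padic_solvability (p : ℕ) [Fact p.Prime] (t b c : ℤ_[p])
    (hb : (p : ℤ_[p]) ∣ b) (hc : (p : ℤ_[p]) ∣ c) :
    ∃ y z : ℤ_[p], t ^ 2 * (b * z - c * y) ^ 2 + y * z = 1 := by
  -- With `y = 1` the equation in `z` has a simple root modulo `p` at `z = 1`.
  let F : Polynomial ℤ_[p] :=
    .C (t ^ 2) * (.C b * .X - .C c) ^ 2 + .X - 1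
  have hF (z : ℤ_[p]) : F.aeval z = t ^ 2 * (b * z - c) ^ 2 + z - 1 := by
    simp [F]
  have hF' : F.derivative.aeval (1 : ℤ_[p]) = 1 + 2 * t ^ 2 * b * (b - c) := by
    simp [F, Polynomial.derivative_pow]
    ring
  have hval : ‖F.aeval (1 : ℤ_[p])‖ < 1 := by
    rw [PadicInt.norm_lt_one_iff_dvd, hF]
    have h : t ^ 2 * (b * 1 - c) ^ 2 + 1 - 1 = (b - c) * (t ^ 2 * (b - c)) := by ring
    exact h ▸ (dvd_sub hb hc).mul_right _
  have hderiv : ‖F.derivative.aeval (1 : ℤ_[p])‖ = 1 := by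
    have h : ‖2 * t ^ 2 * b * (b - c)‖ < 1 :=
      (PadicInt.norm_lt_one_iff_dvd _).2 ((dvd_sub hb hc).mul_left _)
    rw [hF', PadicInt.norm_add_eq_max_of_ne (by rw [norm_one]; exact h.ne'), norm_one,
      max_eq_left h.le]
  obtain ⟨z, hz, -⟩ := hensels_lemma (F := F) (a := 1) (by rw [hderiv, one_pow]; exact hval)
  exact ⟨1, z, by linear_combination (hF z).symm.trans hz⟩
end

section
/- Let p be a prime, λ ≥ 1 an integer, and n = p^λ. For every matrix A in SL₂(ℤ/n) there exists a matrix ε in GL₂(ℤ/n) with det(ε) = −1 such that ε A ε⁻¹ = A⁻¹. -/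
/-- In `ℤ/p^l` every element is a power of `p` times a unit. -/
theorem ZMod.exists_eq_prime_pow_mul_isUnit {p l : ℕ} (hp : p.Prime) (r : ZMod (p ^ l)) :
    ∃ (k : ℕ) (v : ZMod (p ^ l)), IsUnit v ∧ r = (p : ZMod (p ^ l)) ^ k * v := by
  have : NeZero (p ^ l) := ⟨pow_ne_zero l hp.ne_zero⟩
  obtain ⟨m, rfl⟩ := ZMod.natCast_zmod_surjective r
  rcases eq_or_ne m 0 with rfl | hm
  · refine ⟨l, 1, isUnit_one, ?_⟩
    rw [← Nat.cast_pow, ZMod.natCast_self]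
    simp
  · obtain ⟨k, m', hdvd, rfl⟩ := Nat.exists_eq_pow_mul_and_not_dvd hm p hp.ne_one
    refine ⟨k, m', ?_, by push_cast; rfl⟩
    rw [ZMod.isUnit_iff_coprime]
    exact (((Nat.Prime.coprime_iff_not_dvd hp).2 hdvd).symm).pow_right l

theorem ZMod.dvd_total_of_prime_pow {p l : ℕ} (hp : p.Prime) (r s : ZMod (p ^ l)) :
    r ∣ s ∨ s ∣ r := by
  obtain ⟨i, v, hv, rfl⟩ := ZMod.exists_eq_prime_pow_mul_isUnit hp r
  obtain ⟨j, w, hw, rfl⟩ := ZMod.exists_eq_prime_pow_mul_isUnit hp s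
  rw [hv.mul_right_dvd, hw.dvd_mul_right, hw.mul_right_dvd, hv.dvd_mul_right]
  exact (le_total i j).imp (pow_dvd_pow _) (pow_dvd_pow _)

theorem ZMod.isUnit_or_isNilpotent_of_prime_pow {p l : ℕ} (hp : p.Prime) (r : ZMod (p ^ l)) :
    IsUnit r ∨ IsNilpotent r := by
  obtain ⟨k, v, hv, rfl⟩ := ZMod.exists_eq_prime_pow_mul_isUnit hp r
  rcases eq_or_ne k 0 with rfl | hk
  · left
    simpa using hv
  · right
    have hpn : IsNilpotent (p : ZMod (p ^ l)) :=
      ⟨l, by rw [← Nat.cast_pow, ZMod.natCast_self]⟩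
    exact (Commute.all _ _).isNilpotent_mul_right (hpn.pow_of_pos hk)

/-- Over a finite ring the map `z ↦ (c + z * b) ^ 2 + z` is surjective for nilpotent `b`. -/
theorem surjective_sq_add_of_isNilpotent {R : Type*} [CommRing R] [Finite R] {b : R}
    (hb : IsNilpotent b) (c : R) :
    Function.Surjective fun z : R => (c + z * b) ^ 2 + z := by
  refine Finite.surjective_of_injective fun z w h => ?_
  have hu : IsUnit (1 + b * (b * (z + w) + 2 * c)) :=
    ((Commute.all _ _).isNilpotent_mul_right hb).isUnit_one_add
  refine sub_eq_zero.1 (hu.mul_left_eq_zero.1 ?_)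
  linear_combination h

/-- Over a finite local ring with totally ordered divisibility, every traceless matrix is
orthogonal, for the trace form, to a traceless matrix of determinant `-1`. -/
theorem exists_orthogonal_sq_add_mul_eq_one {R : Type*} [CommRing R] [Finite R]
    (hdvd : ∀ r s : R, r ∣ s ∨ s ∣ r) (hnil : ∀ r : R, IsUnit r ∨ IsNilpotent r) (u b c : R) :
    ∃ x y z : R, x * u + y * c + z * b = 0 ∧ x ^ 2 + y * z = 1 := by
  by_cases hbu : b ∣ u
  · obtain ⟨v, rfl⟩ := hbu
    exact ⟨1, 0, -v, by ring, by ring⟩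
  rcases hdvd c u with ⟨v, rfl⟩ | ⟨c', rfl⟩
  · exact ⟨1, -v, 0, by ring, by ring⟩
  obtain ⟨b', rfl⟩ := (hdvd b u).resolve_left hbu
  have hb' : IsNilpotent b' :=
    (hnil b').resolve_left fun h => hbu (h.mul_right_dvd.2 dvd_rfl)
  obtain ⟨z, hz⟩ := surjective_sq_add_of_isNilpotent hb' c' 1
  exact ⟨-(c' + z * b'), 1, z, by ring, by linear_combination hz⟩

open Matrix

/-- Let `p` be a prime, `λ ≥ 1`, and `n = p ^ λ`. For every `A ∈ SL₂(ℤ/n)` there is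
`ε ∈ GL₂(ℤ/n)` with `det ε = -1` such that `ε A ε⁻¹ = A⁻¹`. -/
theorem sl2_zmod_prime_pow_conjugate_to_inverse (p l n : ℕ) (hp : p.Prime) (hl : 1 ≤ l)
    (hn : n = p ^ l) (A : Matrix.SpecialLinearGroup (Fin 2) (ZMod n)) :
    ∃ ε : Matrix.GeneralLinearGroup (Fin 2) (ZMod n),
      ((ε : Matrix (Fin 2) (Fin 2) (ZMod n))).det = -1 ∧
      ε * (A : Matrix.GeneralLinearGroup (Fin 2) (ZMod n)) * ε⁻¹ =
        (A : Matrix.GeneralLinearGroup (Fin 2) (ZMod n))⁻¹ := by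
  subst hn
  have : NeZero (p ^ l) := ⟨pow_ne_zero l hp.ne_zero⟩
  obtain ⟨x, y, z, hlin, hquad⟩ := exists_orthogonal_sq_add_mul_eq_one
    (ZMod.dvd_total_of_prime_pow hp) (ZMod.isUnit_or_isNilpotent_of_prime_pow hp)
    (A 0 0 - A 1 1) (A 0 1) (A 1 0)
  have hdet : (!![x, y; z, -x] : Matrix (Fin 2) (Fin 2) (ZMod (p ^ l))).det = -1 := by
    rw [det_fin_two_of]
    linear_combination -hquad
  refine ⟨GeneralLinearGroup.mk'' !![x, y; z, -x] (hdet ▸ isUnit_one.neg), hdet, ?_⟩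
  have hconj : !![x, y; z, -x] * A.1 = adjugate A.1 * !![x, y; z, -x] := by
    rw [adjugate_fin_two]
    ext i j
    fin_cases i <;> fin_cases j <;> simp [mul_apply, Fin.sum_univ_two] <;> grind
  rw [mul_inv_eq_iff_eq_mul, ← map_inv]
  exact Units.ext hconj
end

section
/- Let n ≥ 1 be any integer. For every matrix A in SL₂(ℤ/n) there exists a matrix ε in GL₂(ℤ/n) with det(ε) = −1 such that ε A ε⁻¹ = A⁻¹. -/
open Matrix

/-- The product of those prime factors of `n` that satisfy `S` is divisible by precisely those. -/
lemma exists_nat_prime_dvd_iff {n : ℕ} (hn : n ≠ 0) (S : ℕ → Prop) :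
    ∃ r : ℕ, ∀ p : ℕ, p.Prime → p ∣ n → (p ∣ r ↔ S p) := by
  classical
  refine ⟨∏ q ∈ n.primeFactors.filter S, q, fun p hp hpn => ?_⟩
  rw [hp.prime.dvd_finsetProd_iff]
  constructor
  · rintro ⟨q, hq, hpq⟩
    obtain ⟨hq, hS⟩ := Finset.mem_filter.1 hq
    rwa [(Nat.prime_dvd_prime_iff_eq hp (Nat.prime_of_mem_primeFactors hq)).1 hpq]
  · intro hS
    exact ⟨p, Finset.mem_filter.2 ⟨Nat.mem_primeFactors.2 ⟨hp, hpn, hn⟩, hS⟩, dvd_rfl⟩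

/-- A primitive binary quadratic form over `ℤ` represents a unit modulo every `n ≠ 0`. -/
lemma exists_isUnit_quadratic_form {n : ℕ} (hn : n ≠ 0) (u v w : ℤ)
    (h : ∀ p : ℕ, p.Prime → ¬ ((p : ℤ) ∣ u ∧ (p : ℤ) ∣ v ∧ (p : ℤ) ∣ w)) :
    ∃ r s : ℤ, IsUnit ((v * r ^ 2 - u * r * s - w * s ^ 2 : ℤ) : ZMod n) := by
  obtain ⟨r, hr⟩ := exists_nat_prime_dvd_iff hn fun p => (p : ℤ) ∣ v ∧ ¬ (p : ℤ) ∣ w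
  obtain ⟨s, hs⟩ := exists_nat_prime_dvd_iff hn fun p => ¬ (p : ℤ) ∣ v
  refine ⟨r, s, ?_⟩
  rw [ZMod.coe_int_isUnit_iff_isCoprime, Int.isCoprime_iff_gcd_eq_one]
  by_contra hgcd
  obtain ⟨p, hp, hpg⟩ := Nat.exists_prime_and_dvd hgcd
  have hpn : p ∣ n := Int.natCast_dvd_natCast.1
    ((Int.natCast_dvd_natCast.2 hpg).trans (Int.gcd_dvd_left _ _))
  have hpq : (p : ℤ) ∣ v * r ^ 2 - u * r * s - w * s ^ 2 :=
    (Int.natCast_dvd_natCast.2 hpg).trans (Int.gcd_dvd_right _ _)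
  have : Fact p.Prime := ⟨hp⟩
  specialize hr p hp hpn
  specialize hs p hp hpn
  specialize h p hp
  simp only [← ZMod.intCast_zmod_eq_zero_iff_dvd, ← ZMod.natCast_eq_zero_iff] at *
  push_cast at *
  by_cases hv : (v : ZMod p) = 0 <;> by_cases hw : (w : ZMod p) = 0 <;> simp_all

/-- If `A = d + g B` and `e = (r, s)` is a vector such that `e, B e` is a basis, then `A` is
conjugated to its adjugate by the involution that fixes `e` and exchanges `B e` with
`(adj B) e`. -/
lemma exists_conj_eq_adjugate {R : Type*} [CommRing R] (d g u v w r s : R)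
    (h : IsUnit (v * r ^ 2 - u * r * s - w * s ^ 2)) :
    ∃ E : Matrix (Fin 2) (Fin 2) R, E.det = -1 ∧
      E * !![d + g * u, g * w; g * v, d] = !![d, -(g * w); -(g * v), d + g * u] * E := by
  obtain ⟨q, hq⟩ := h.exists_right_inv
  refine ⟨!![q * (v * r ^ 2 + w * s ^ 2), -(q * (u * r ^ 2 + 2 * w * r * s));
    q * (2 * v * r * s - u * s ^ 2), -(q * (v * r ^ 2 + w * s ^ 2))], ?_, ?_⟩
  · rw [det_fin_two_of]
    linear_combination (-(v * r ^ 2 - u * r * s - w * s ^ 2) * q - 1) * hq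
  · ext i j
    fin_cases i <;> fin_cases j <;> simp [Matrix.mul_apply, Fin.sum_univ_two] <;> ring

/-- Three integers are a common multiple of a primitive triple. -/
lemma exists_primitive_triple (x y z : ℤ) :
    ∃ g u v w : ℤ, x = g * u ∧ y = g * v ∧ z = g * w ∧
      ∀ p : ℕ, p.Prime → ¬ ((p : ℤ) ∣ u ∧ (p : ℤ) ∣ v ∧ (p : ℤ) ∣ w) := by
  obtain ⟨f, hf, hf1⟩ := Finset.extract_gcd ![x, y, z] (Finset.univ_nonempty (α := Fin 3))
  refine ⟨_, f 0, f 1, f 2, hf 0 (Finset.mem_univ _), hf 1 (Finset.mem_univ _),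
    hf 2 (Finset.mem_univ _), fun p hp ⟨h0, h1, h2⟩ => ?_⟩
  have hdvd : (p : ℤ) ∣ Finset.univ.gcd f := Finset.dvd_gcd fun i _ => by
    fin_cases i <;> assumption
  rw [hf1] at hdvd
  exact (Nat.prime_iff_prime_int.1 hp).not_dvd_one hdvd

theorem sl2_zmod_conjugate_to_inverse (n : ℕ) (hn : 1 ≤ n)
    (A : Matrix.SpecialLinearGroup (Fin 2) (ZMod n)) :
    ∃ ε : Matrix.GeneralLinearGroup (Fin 2) (ZMod n),
      ((ε : Matrix (Fin 2) (Fin 2) (ZMod n))).det = -1 ∧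
      ε * (A : Matrix.GeneralLinearGroup (Fin 2) (ZMod n)) * ε⁻¹ =
        (A : Matrix.GeneralLinearGroup (Fin 2) (ZMod n))⁻¹ := by
  have hn0 : n ≠ 0 := Nat.one_le_iff_ne_zero.1 hn
  obtain ⟨a, ha⟩ := ZMod.intCast_surjective (A.1 0 0)
  obtain ⟨b, hb⟩ := ZMod.intCast_surjective (A.1 0 1)
  obtain ⟨c, hc⟩ := ZMod.intCast_surjective (A.1 1 0)
  obtain ⟨d, hd⟩ := ZMod.intCast_surjective (A.1 1 1)
  obtain ⟨g, u, v, w, hu, hv, hw, hprim⟩ := exists_primitive_triple (a - d) c b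
  obtain ⟨r, s, hrs⟩ := exists_isUnit_quadratic_form hn0 u v w hprim
  push_cast at hrs
  obtain ⟨E, hdet, hE⟩ := exists_conj_eq_adjugate (d : ZMod n) g u v w r s hrs
  have hA : A.1 = !![(d : ZMod n) + g * u, g * w; g * v, d] := by
    rw [Matrix.eta_fin_two A.1, ← ha, ← hb, ← hc, ← hd, eq_add_of_sub_eq' hu, hv, hw]
    push_cast
    rfl
  have hadj : A.1.adjugate = !![(d : ZMod n), -(g * w); -(g * v), d + g * u] := by
    rw [hA, adjugate_fin_two_of]
  rw [← hA, ← hadj] at hE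
  have hunit : IsUnit E := (isUnit_iff_isUnit_det E).2 (hdet ▸ isUnit_one.neg)
  obtain ⟨ε, rfl⟩ := hunit
  refine ⟨ε, hdet, ?_⟩
  rw [mul_inv_eq_iff_eq_mul]
  apply Units.ext
  have hinv : (((A : Matrix.GeneralLinearGroup (Fin 2) (ZMod n))⁻¹ :
      Matrix.GeneralLinearGroup (Fin 2) (ZMod n)) : Matrix (Fin 2) (Fin 2) (ZMod n)) =
      A.1.adjugate := rfl
  rw [Units.val_mul, Units.val_mul, hinv]
  exact hE
end

section
/- Let n ≥ 1 be an integer and let ε be an element of GL₂(ℤ/n) with det(ε) = −1. Then for every g in SL₂(ℤ/n), the matrices ε g ε⁻¹ and g⁻¹ are conjugate by an element of SL₂(ℤ/n). -/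
open Matrix

/-- A primitive integral binary quadratic form represents an integer coprime to `n`. -/
theorem exists_isCoprime_binary_quadratic (n : ℕ) (hn : n ≠ 0) (A B C : ℤ)
    (h : ∀ p : ℕ, p.Prime → (p : ℤ) ∣ A → (p : ℤ) ∣ B → ¬ (p : ℤ) ∣ C) :
    ∃ x y : ℤ, IsCoprime (A * x ^ 2 + B * x * y + C * y ^ 2) (n : ℤ) := by
  classical
  have prod_dvd : ∀ (P : ℕ → Prop) (p : ℕ), p.Prime → p ∣ n →
      ((p : ℤ) ∣ ((∏ q ∈ n.primeFactors with P q, q : ℕ) : ℤ) ↔ P p) := by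
    intro P p hp hpn
    rw [Int.natCast_dvd_natCast, hp.prime.dvd_finsetProd_iff]
    constructor
    · rintro ⟨q, hq, hpq⟩
      rw [Finset.mem_filter, Nat.mem_primeFactors] at hq
      rw [(Nat.prime_dvd_prime_iff_eq hp hq.1.1).1 hpq]
      exact hq.2
    · intro hP
      exact ⟨p, Finset.mem_filter.2 ⟨Nat.mem_primeFactors.2 ⟨hp, hpn, hn⟩, hP⟩, dvd_rfl⟩
  let P : ℕ → Prop := fun p => (p : ℤ) ∣ A ∧ ¬ (p : ℤ) ∣ C
  let R : ℕ → Prop := fun p => ¬ (p : ℤ) ∣ A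
  obtain ⟨x, hx⟩ : ∃ x : ℤ, ∀ p : ℕ, p.Prime → p ∣ n → ((p : ℤ) ∣ x ↔ P p) :=
    ⟨_, prod_dvd P⟩
  obtain ⟨y, hy⟩ : ∃ y : ℤ, ∀ p : ℕ, p.Prime → p ∣ n → ((p : ℤ) ∣ y ↔ R p) :=
    ⟨_, prod_dvd R⟩
  refine ⟨x, y, ?_⟩
  rw [Int.isCoprime_iff_gcd_eq_one, ← Int.natAbs_natCast n]
  refine Nat.Coprime.symm (Nat.coprime_of_dvd fun p hp hpn hpQ => ?_)
  rw [Int.natAbs_natCast] at hpn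
  rw [← Int.natCast_dvd] at hpQ
  have hp' : Prime (p : ℤ) := Nat.prime_iff_prime_int.1 hp
  have hx := hx p hp hpn
  have hy := hy p hp hpn
  by_cases hA : (p : ℤ) ∣ A
  · have hy' : ¬ (p : ℤ) ∣ y := fun hd => hy.1 hd hA
    by_cases hC : (p : ℤ) ∣ C
    · have hx' : ¬ (p : ℤ) ∣ x := fun hd => (hx.1 hd).2 hC
      have hd : (p : ℤ) ∣ B * x * y := by
        have := (hpQ.sub (hA.mul_right (x ^ 2))).sub (hC.mul_right (y ^ 2))
        ring_nf at this ⊢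
        exact this
      rcases hp'.dvd_or_dvd hd with hd | hd
      · rcases hp'.dvd_or_dvd hd with hd | hd
        · exact h p hp hA hd hC
        · exact hx' hd
      · exact hy' hd
    · have hd : (p : ℤ) ∣ C * y ^ 2 := by
        have := (hpQ.sub (hA.mul_right (x ^ 2))).sub ((hx.2 ⟨hA, hC⟩).mul_right (B * y))
        ring_nf at this ⊢
        exact this
      rcases hp'.dvd_or_dvd hd with hd | hd
      · exact hC hd
      · exact hy' (hp'.dvd_of_dvd_pow hd)
  · have hd : (p : ℤ) ∣ A * x ^ 2 := by
      have := hpQ.sub ((hy.2 hA).mul_right (B * x + C * y))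
      ring_nf at this ⊢
      exact this
    rcases hp'.dvd_or_dvd hd with hd | hd
    · exact hA hd
    · exact hA (hx.1 (hp'.dvd_of_dvd_pow hd)).1

/-- Any three integers are a common multiple of three integers with no common prime factor. -/
theorem exists_eq_mul_primitive_triple (a b c : ℤ) :
    ∃ δ a' b' c' : ℤ, a = δ * a' ∧ b = δ * b' ∧ c = δ * c' ∧
      ∀ p : ℕ, p.Prime → (p : ℤ) ∣ a' → (p : ℤ) ∣ b' → ¬ (p : ℤ) ∣ c' := by
  obtain ⟨f, hf, hgcd⟩ :=
    Finset.extract_gcd ![a, b, c] (Finset.univ_nonempty (α := Fin 3))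
  refine ⟨_, f 0, f 1, f 2, hf 0 (Finset.mem_univ _), hf 1 (Finset.mem_univ _),
    hf 2 (Finset.mem_univ _), fun p hp ha hb hc => ?_⟩
  have hd : (p : ℤ) ∣ Finset.univ.gcd f := Finset.dvd_gcd fun i _ => by
    fin_cases i <;> assumption
  rw [hgcd] at hd
  exact (Nat.prime_iff_prime_int.1 hp).not_isUnit (isUnit_of_dvd_one hd)

/-- Every `2 × 2` matrix over `ℤ/n` is intertwined with its adjugate by a matrix of
determinant `-1`. -/
theorem exists_det_eq_neg_one_mul_eq_adjugate_mul (n : ℕ) (hn : n ≠ 0)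
    (g : Matrix (Fin 2) (Fin 2) (ZMod n)) :
    ∃ X : Matrix (Fin 2) (Fin 2) (ZMod n), X.det = -1 ∧ X * g = g.adjugate * X := by
  obtain ⟨u₀, hu₀⟩ := ZMod.intCast_surjective (g 0 0 - g 1 1)
  obtain ⟨b₀, hb₀⟩ := ZMod.intCast_surjective (g 0 1)
  obtain ⟨c₀, hc₀⟩ := ZMod.intCast_surjective (g 1 0)
  obtain ⟨δ, u, b, c, rfl, rfl, rfl, hprim⟩ := exists_eq_mul_primitive_triple u₀ b₀ c₀
  obtain ⟨x, y, hxy⟩ := exists_isCoprime_binary_quadratic n hn c (-u) (-b)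
    fun p hp hc hu hb => hprim p hp ((dvd_neg).1 hu) ((dvd_neg).1 hb) hc
  obtain ⟨k, m, hk⟩ := hxy
  have hk := congrArg (Int.cast : ℤ → ZMod n) hk
  push_cast at hk hu₀ hb₀ hc₀
  rw [ZMod.natCast_self, mul_zero, add_zero] at hk
  generalize (u : ZMod n) = u at *
  generalize (b : ZMod n) = b at *
  generalize (c : ZMod n) = c at *
  generalize (x : ZMod n) = x at *
  generalize (y : ZMod n) = y at *
  generalize (k : ZMod n) = k at *
  generalize (δ : ZMod n) = δ at *
  have ha : g 0 0 = g 1 1 + δ * u := by rw [hu₀]; ring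
  refine ⟨!![k * (c * x ^ 2 + b * y ^ 2), -k * (u * x ^ 2 + 2 * b * x * y);
    k * (2 * c * x * y - u * y ^ 2), -k * (c * x ^ 2 + b * y ^ 2)], ?_, ?_⟩
  · rw [det_fin_two_of]
    linear_combination (-(k * (c * x ^ 2 + -u * x * y + -b * y ^ 2)) - 1) * hk
  · rw [adjugate_fin_two]
    ext i j
    fin_cases i <;> fin_cases j <;>
      simp [Matrix.mul_apply, Fin.sum_univ_two, ha, ← hb₀, ← hc₀] <;> ring

/-- Let `n ≥ 1` and `ε ∈ GL₂(ℤ/n)` with `det ε = -1`. Then for every `g ∈ SL₂(ℤ/n)`,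
the matrices `ε g ε⁻¹` and `g⁻¹` are conjugate by an element of `SL₂(ℤ/n)`. -/
theorem conj_by_det_neg_one_is_sl2_conjugate_to_inverse (n : ℕ) (hn : 1 ≤ n)
    (ε : Matrix.GeneralLinearGroup (Fin 2) (ZMod n))
    (hε : ((ε : Matrix (Fin 2) (Fin 2) (ZMod n))).det = -1)
    (g : Matrix.SpecialLinearGroup (Fin 2) (ZMod n)) :
    ∃ h : Matrix.SpecialLinearGroup (Fin 2) (ZMod n),
      (h : Matrix.GeneralLinearGroup (Fin 2) (ZMod n)) *
          (ε * (g : Matrix.GeneralLinearGroup (Fin 2) (ZMod n)) * ε⁻¹) *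
          (h : Matrix.GeneralLinearGroup (Fin 2) (ZMod n))⁻¹ =
        (g : Matrix.GeneralLinearGroup (Fin 2) (ZMod n))⁻¹ := by
  obtain ⟨X, hX, hXg⟩ :=
    exists_det_eq_neg_one_mul_eq_adjugate_mul n (Nat.one_le_iff_ne_zero.1 hn) g
  have hε' : ((ε⁻¹ : GeneralLinearGroup (Fin 2) (ZMod n)) :
      Matrix (Fin 2) (Fin 2) (ZMod n)).det = -1 := by
    have := congrArg Matrix.det (Units.inv_mul ε)
    rw [det_mul, hε, det_one] at this
    linear_combination -this
  let h : SpecialLinearGroup (Fin 2) (ZMod n) :=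
    ⟨X * (ε⁻¹ : GeneralLinearGroup (Fin 2) (ZMod n)), by rw [det_mul, hX, hε']; ring⟩
  refine ⟨h, ?_⟩
  have hhε : (((h : GeneralLinearGroup (Fin 2) (ZMod n)) * ε :
      GeneralLinearGroup (Fin 2) (ZMod n)) : Matrix (Fin 2) (Fin 2) (ZMod n)) = X := by
    change X * (ε⁻¹ : GeneralLinearGroup (Fin 2) (ZMod n)) *
      (ε : Matrix (Fin 2) (Fin 2) (ZMod n)) = X
    rw [Matrix.mul_assoc, Units.inv_mul, Matrix.mul_one]
  have key : (h : GeneralLinearGroup (Fin 2) (ZMod n)) * ε * g =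
      (g : GeneralLinearGroup (Fin 2) (ZMod n))⁻¹ * (h * ε) := by
    apply Units.ext
    rw [Units.val_mul, Units.val_mul _ ((h : GeneralLinearGroup (Fin 2) (ZMod n)) * ε), hhε]
    exact hXg
  rw [mul_inv_eq_iff_eq_mul, ← mul_assoc, ← mul_assoc, key]
  group
end

section
/- Let p be a prime with p ≡ 3 (mod 4), and let A be the matrix [[1,1],[0,1]] in SL₂(ℤ_p). Then there is no matrix ε in SL₂(ℤ_p) such that ε A ε⁻¹ = A⁻¹; that is, A is not conjugate in SL₂(ℤ_p) to its inverse. -/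
open Matrix

/-- Let `p ≡ 3 (mod 4)` be a prime. The matrix `[[1,1],[0,1]]` is not conjugate inside
`SL₂(ℤ_p)` to its inverse. -/
theorem unipotent_not_sl2_conjugate_to_inverse (p : ℕ) [Fact p.Prime] (hp : p % 4 = 3)
    (A : Matrix.SpecialLinearGroup (Fin 2) ℤ_[p])
    (hA : (A : Matrix (Fin 2) (Fin 2) ℤ_[p]) = !![1, 1; 0, 1]) :
    ¬ ∃ ε : Matrix.SpecialLinearGroup (Fin 2) ℤ_[p], ε * A * ε⁻¹ = A⁻¹ := by
  rintro ⟨ε, h⟩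
  have hε : A * (ε * A) = ε := by
    rw [mul_inv_eq_iff_eq_mul.mp h, mul_inv_cancel_left]
  have hM := congrArg (fun B : Matrix.SpecialLinearGroup (Fin 2) ℤ_[p] =>
    (B : Matrix (Fin 2) (Fin 2) ℤ_[p])) hε
  simp only [Matrix.SpecialLinearGroup.coe_mul, hA] at hM
  have h00 := congrFun (congrFun hM 0) 0
  have h01 := congrFun (congrFun hM 0) 1
  simp [Matrix.mul_apply, Fin.sum_univ_two] at h00 h01
  have hdet := ε.det_coe
  rw [Matrix.det_fin_two] at hdet
  have hsq : (ε 0 0) ^ 2 = -1 := by grind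
  have hmod : (PadicInt.toZMod (ε 0 0)) ^ 2 = (-1 : ZMod p) := by
    rw [← map_pow, hsq, map_neg, map_one]
  exact ZMod.mod_four_ne_three_of_sq_eq_neg_one hmod hp
end
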